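/- arXiv:2108.01503 — 2 statements merged into one kernel-verified Lean document; each statement's English description precedes it below -/
import Mathlib

section
/- For all session types R and S: R is fairly compliant with S if and only if (R, S) ∈ Gen(I_C, Ico_C), the interpretation of the generalized inference system for fair compliance. -/
/-- An inference system over a universe `U`: a set of rules `(premises, conclusion)`. -/
abbrev InfSys (U : Type) := Set (Set U × U)

/-- The (monotone) inference operator associated with an inference system. -/
def infOp {U : Type} (I : InfSys U) : Set U →o Set U where
  toFun X := {j | ∃ pr, pr ⊆ X ∧ (pr, j) ∈ I}
  monotone' := by
    intro X Y h j hj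
    obtain ⟨pr, hpr, hr⟩ := hj
    exact ⟨pr, hpr.trans h, hr⟩

/-- Inductive interpretation: least fixed point of the inference operator. -/
def Ind {U : Type} (I : InfSys U) : Set U := OrderHom.lfp (infOp I)

/-- Coinductive interpretation: greatest fixed point of the inference operator. -/
def CoInd {U : Type} (I : InfSys U) : Set U := OrderHom.gfp (infOp I)

/-- Interpretation of a generalized inference system `(I, Ico)`: the greatest
post-fixed point of `infOp I` included in `Ind (I ∪ Ico)`, i.e. the union of
all `X` with `X ⊆ infOp I X` and `X ⊆ Ind (I ∪ Ico)`. -/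
def Gen {U : Type} (I Ico : InfSys U) : Set U :=
  sSup {X | X ⊆ infOp I X ∧ X ⊆ Ind (I ∪ Ico)}

/-- Tags for the three constructors of session types. -/
inductive STag : Type | nil | inp | out

/-- The polynomial functor `X ↦ Unit ⊕ (V → X) ⊕ (V → X)`. -/
def STF (V : Type) : PFunctor.{0} := ⟨STag, fun t => match t with
  | .nil => Empty
  | .inp => V
  | .out => V⟩

/-- Session types over `V`: the final coalgebra (M-type) of `STF V`. -/
def SessionType (V : Type) : Type := (STF V).M

/-- The `nil` session type. -/
def SessionType.nil (V : Type) : SessionType V := PFunctor.M.mk ⟨STag.nil, Empty.elim⟩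

/-- Input session type. -/
def SessionType.inp {V : Type} (f : V → SessionType V) : SessionType V :=
  PFunctor.M.mk ⟨STag.inp, f⟩

/-- Output session type. -/
def SessionType.out {V : Type} (f : V → SessionType V) : SessionType V :=
  PFunctor.M.mk ⟨STag.out, f⟩

/-- Input/output actions `?x` and `!x`. -/
inductive Act (V : Type) : Type
  | inp (x : V)
  | out (x : V)

/-- Labeled transitions of session types:
`inp f −?x→ f x` for every `x`, and `out f −!x→ f x` for every `x ∈ dom f`. -/
inductive Transition {V : Type} : SessionType V → Act V → SessionType V → Prop
  | inp (f : V → SessionType V) (x : V) : Transition (.inp f) (.inp x) (f x)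
  | out (f : V → SessionType V) (x : V) :
      f x ≠ SessionType.nil V → Transition (.out f) (.out x) (f x)

/-- `TransSeq T φ S` means `T ⇒φ S` (composite of transitions along `φ`). -/
inductive TransSeq {V : Type} : SessionType V → List (Act V) → SessionType V → Prop
  | refl (T : SessionType V) : TransSeq T [] T
  | step {T T' S : SessionType V} {α : Act V} {φ : List (Act V)} :
      Transition T α T' → TransSeq T' φ S → TransSeq T (α :: φ) S

/-- Traces of a session type: `{φ | ∃ S ≠ nil, T ⇒φ S}`. -/
def Traces {V : Type} (T : SessionType V) : Set (List (Act V)) :=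
  {φ | ∃ S, S ≠ SessionType.nil V ∧ TransSeq T φ S}

/-- Fair termination: each trace extends to a maximal one. -/
def FairlyTerminating {V : Type} (T : SessionType V) : Prop :=
  ∀ φ ∈ Traces T, ∃ ψ, (φ ++ ψ) ∈ Traces T ∧ ∀ χ, ((φ ++ ψ) ++ χ) ∈ Traces T → χ = []

/-- Complementary action. -/
def coAct {V : Type} : Act V → Act V
  | .inp x => .out x
  | .out x => .inp x

/-- Reduction of sessions: client and server synchronize. -/
def Red {V : Type} (p q : SessionType V × SessionType V) : Prop :=
  ∃ α, Transition p.1 (coAct α) q.1 ∧ Transition p.2 α q.2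

/-- Reflexive-transitive closure of session reduction. -/
def Reds {V : Type} : SessionType V × SessionType V → SessionType V × SessionType V → Prop :=
  Relation.ReflTransGen Red

/-- A successful session: the client is `end!` and the server has not failed. -/
def Successful {V : Type} (p : SessionType V × SessionType V) : Prop :=
  (∃ f, p.1 = SessionType.out f ∧ ∀ x, f x = SessionType.nil V) ∧ p.2 ≠ SessionType.nil V

/-- A session may succeed if it reduces to a successful one. -/
def MaySucceed {V : Type} (p : SessionType V × SessionType V) : Prop :=
  ∃ q, Reds p q ∧ Successful q

/-- `R` is compliant with `S`: every stuck reduct is successful. -/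
def Compliant {V : Type} (R S : SessionType V) : Prop :=
  ∀ p, Reds (R, S) p → (∀ q, ¬ Red p q) → Successful p

/-- `R` is fairly compliant with `S`: every reduct may succeed. -/
def FairCompliant {V : Type} (R S : SessionType V) : Prop :=
  ∀ p, Reds (R, S) p → MaySucceed p

/-- Plain rules `I_C` of the fair-compliance GIS (c-success, c-inp-out, c-out-inp). -/
def IC (V : Type) : InfSys (SessionType V × SessionType V) :=
  {r | ∃ (f : V → SessionType V) (S : SessionType V),
        (∀ x, f x = SessionType.nil V) ∧ S ≠ SessionType.nil V ∧
        r = (∅, (SessionType.out f, S))} ∪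
  {r | ∃ f g, (∃ x, g x ≠ SessionType.nil V) ∧
        r = ({p | ∃ x, g x ≠ SessionType.nil V ∧ p = (f x, g x)},
             (SessionType.inp f, SessionType.out g))} ∪
  {r | ∃ f g, (∃ x, f x ≠ SessionType.nil V) ∧
        r = ({p | ∃ x, f x ≠ SessionType.nil V ∧ p = (f x, g x)},
             (SessionType.out f, SessionType.inp g))}

/-- Corules `Ico_C` of the fair-compliance GIS (c-sync). -/
def IcoC (V : Type) : InfSys (SessionType V × SessionType V) :=
  {r | ∃ f g x, f x ≠ SessionType.nil V ∧
        r = ({(f x, g x)}, (SessionType.out f, SessionType.inp g))} ∪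
  {r | ∃ f g x, g x ≠ SessionType.nil V ∧
        r = ({(f x, g x)}, (SessionType.inp f, SessionType.out g))}

theorem SessionType.inp_injective {V : Type} :
    Function.Injective (SessionType.inp : (V → SessionType V) → SessionType V) := by
  intro f g h
  exact eq_of_heq (Sigma.mk.inj (PFunctor.M.mk_inj h)).2

theorem SessionType.out_injective {V : Type} :
    Function.Injective (SessionType.out : (V → SessionType V) → SessionType V) := by
  intro f g h
  exact eq_of_heq (Sigma.mk.inj (PFunctor.M.mk_inj h)).2

theorem SessionType.inp_ne_out {V : Type} (f g : V → SessionType V) :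
    SessionType.inp f ≠ SessionType.out g := by
  intro h
  exact STag.noConfusion (Sigma.mk.inj (PFunctor.M.mk_inj h)).1

theorem red_iff {V : Type} {p q : SessionType V × SessionType V} :
    Red p q ↔
      (∃ f g x, g x ≠ SessionType.nil V ∧
        p = (SessionType.inp f, SessionType.out g) ∧ q = (f x, g x)) ∨
      (∃ f g x, f x ≠ SessionType.nil V ∧
        p = (SessionType.out f, SessionType.inp g) ∧ q = (f x, g x)) := by
  constructor
  · obtain ⟨p₁, p₂⟩ := p
    obtain ⟨q₁, q₂⟩ := q
    rintro ⟨α | α, h₁, h₂⟩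
    · cases h₁ with
      | out f _ hf => cases h₂ with
        | inp g => exact Or.inr ⟨f, g, α, hf, rfl, rfl⟩
    · cases h₁ with
      | inp f => cases h₂ with
        | out g _ hg => exact Or.inl ⟨f, g, α, hg, rfl, rfl⟩
  · rintro (⟨f, g, x, h, rfl, rfl⟩ | ⟨f, g, x, h, rfl, rfl⟩)
    · exact ⟨.out x, .inp f x, .out g x h⟩
    · exact ⟨.inp x, .out f x h, .inp g x⟩

theorem MaySucceed.of_red {V : Type} {p q : SessionType V × SessionType V}
    (h : Red p q) : MaySucceed q → MaySucceed p
  | ⟨r, hr, hs⟩ => ⟨r, Relation.ReflTransGen.head h hr, hs⟩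

/-- A post-fixed point of the plain rules is closed under reduction. -/
theorem mem_of_red {V : Type} {X : Set (SessionType V × SessionType V)}
    (hX : X ⊆ infOp (IC V) X) {p q : SessionType V × SessionType V}
    (hp : p ∈ X) (h : Red p q) : q ∈ X := by
  obtain ⟨pr, hpr, (⟨f, S, hf, -, hr⟩ | ⟨f, g, -, hr⟩) | ⟨f, g, -, hr⟩⟩ := hX hp
  all_goals
    obtain ⟨rfl, rfl⟩ := Prod.mk.inj hr
    obtain ⟨f', g', x, hx, he, rfl⟩ | ⟨f', g', x, hx, he, rfl⟩ := red_iff.1 h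
    all_goals obtain ⟨h₁, h₂⟩ := Prod.mk.inj he
  · exact absurd h₁.symm (SessionType.inp_ne_out _ _)
  · obtain rfl := SessionType.out_injective h₁
    exact absurd (hf x) hx
  · obtain rfl := SessionType.inp_injective h₁
    obtain rfl := SessionType.out_injective h₂
    exact hpr ⟨x, hx, rfl⟩
  · exact absurd h₁ (SessionType.inp_ne_out _ _)
  · exact absurd h₁.symm (SessionType.inp_ne_out _ _)
  · obtain rfl := SessionType.out_injective h₁
    obtain rfl := SessionType.inp_injective h₂
    exact hpr ⟨x, hx, rfl⟩

/-- Rules together with corules derive exactly the sessions that may succeed. -/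
theorem mem_ind_iff_maySucceed {V : Type} {p : SessionType V × SessionType V} :
    p ∈ Ind (IC V ∪ IcoC V) ↔ MaySucceed p := by
  constructor
  · suffices h : Ind (IC V ∪ IcoC V) ≤ {p | MaySucceed p} from fun hp => h hp
    refine OrderHom.lfp_le _ ?_
    rintro p ⟨pr, hpr, ((⟨f, S, hf, hS, hr⟩ | ⟨f, g, ⟨x, hx⟩, hr⟩) | ⟨f, g, ⟨x, hx⟩, hr⟩) |
      ⟨f, g, x, hx, hr⟩ | ⟨f, g, x, hx, hr⟩⟩
    all_goals obtain ⟨rfl, rfl⟩ := Prod.mk.inj hr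
    · exact ⟨_, .refl, ⟨f, rfl, hf⟩, hS⟩
    · exact .of_red (red_iff.2 (.inl ⟨f, g, x, hx, rfl, rfl⟩)) (hpr ⟨x, hx, rfl⟩)
    · exact .of_red (red_iff.2 (.inr ⟨f, g, x, hx, rfl, rfl⟩)) (hpr ⟨x, hx, rfl⟩)
    · exact .of_red (red_iff.2 (.inr ⟨f, g, x, hx, rfl, rfl⟩)) (hpr rfl)
    · exact .of_red (red_iff.2 (.inl ⟨f, g, x, hx, rfl, rfl⟩)) (hpr rfl)
  · have rule {pr : Set (SessionType V × SessionType V)} {j}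
        (hpr : pr ⊆ Ind (IC V ∪ IcoC V)) (hr : (pr, j) ∈ IC V ∪ IcoC V) :
        j ∈ Ind (IC V ∪ IcoC V) :=
      OrderHom.map_le_lfp (infOp _) le_rfl ⟨pr, hpr, hr⟩
    rintro ⟨q, hpq, ⟨f, hq, hf⟩, hS⟩
    induction hpq using Relation.ReflTransGen.head_induction_on with
    | refl =>
      obtain ⟨R, S⟩ := q
      obtain rfl : R = _ := hq
      exact rule (Set.empty_subset _) (.inl (.inl (.inl ⟨f, S, hf, hS, rfl⟩)))
    | head h _ ih =>
      obtain ⟨f, g, x, hx, rfl, rfl⟩ | ⟨f, g, x, hx, rfl, rfl⟩ := red_iff.1 h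
      · exact rule (Set.singleton_subset_iff.2 ih) (.inr (.inr ⟨f, g, x, hx, rfl⟩))
      · exact rule (Set.singleton_subset_iff.2 ih) (.inr (.inl ⟨f, g, x, hx, rfl⟩))

theorem FairCompliant.of_red {V : Type} {p q : SessionType V × SessionType V}
    (hp : FairCompliant p.1 p.2) (h : Red p q) : FairCompliant q.1 q.2 :=
  fun r hr => hp r (Relation.ReflTransGen.head h hr)

/-- Fairly compliant sessions form a post-fixed point of the plain rules. -/
theorem fairCompliant_subset_infOp {V : Type} :
    {p : SessionType V × SessionType V | FairCompliant p.1 p.2} ⊆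
      infOp (IC V) {p | FairCompliant p.1 p.2} := by
  intro p hp
  obtain ⟨q, hpq, hs⟩ := hp p .refl
  obtain rfl | ⟨r, h, -⟩ := Relation.ReflTransGen.cases_head hpq
  · obtain ⟨R, S⟩ := p
    obtain ⟨⟨f, hR, hf⟩, hS⟩ := hs
    obtain rfl : R = _ := hR
    exact ⟨∅, Set.empty_subset _, .inl (.inl ⟨f, S, hf, hS, rfl⟩)⟩
  · obtain ⟨f, g, x, hx, rfl, rfl⟩ | ⟨f, g, x, hx, rfl, rfl⟩ := red_iff.1 h
    · refine ⟨_, ?_, .inl (.inr ⟨f, g, ⟨x, hx⟩, rfl⟩)⟩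
      rintro _ ⟨y, hy, rfl⟩
      exact FairCompliant.of_red hp (red_iff.2 (.inl ⟨f, g, y, hy, rfl, rfl⟩))
    · refine ⟨_, ?_, .inr ⟨f, g, ⟨x, hx⟩, rfl⟩⟩
      rintro _ ⟨y, hy, rfl⟩
      exact FairCompliant.of_red hp (red_iff.2 (.inr ⟨f, g, y, hy, rfl, rfl⟩))

/-- Fair compliance coincides with the interpretation of the generalized
inference system for fair compliance. -/
theorem stmt11 {V : Type} [Nontrivial V] (R S : SessionType V) :
    FairCompliant R S ↔ (R, S) ∈ Gen (IC V) (IcoC V) := by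
  constructor
  · intro h
    exact Set.mem_sUnion.2 ⟨_, ⟨fairCompliant_subset_infOp,
      fun p hp => mem_ind_iff_maySucceed.2 (hp p .refl)⟩, h⟩
  · intro h p hp
    obtain ⟨X, ⟨hX, hInd⟩, hRS⟩ := Set.mem_sUnion.1 h
    refine mem_ind_iff_maySucceed.1 (hInd ?_)
    induction hp with
    | refl => exact hRS
    | tail _ hstep ih => exact mem_of_red hX ih hstep
end

section
/- For all session types T and S: T is a subtype of S if and only if (T, S) ∈ CoInd(I_F), the coinductive interpretation of the plain rules of the fair-subtyping GIS. -/
/-- Plain rules `I_F` of the fair-subtyping GIS (s-nil, s-end, s-inp, s-out). -/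
def IF (V : Type) : InfSys (SessionType V × SessionType V) :=
  {r | ∃ T, r = (∅, (SessionType.nil V, T))} ∪
  {r | ∃ (f : V → SessionType V) (T : SessionType V),
        (∀ x, f x = SessionType.nil V) ∧ T ≠ SessionType.nil V ∧
        (r = (∅, (SessionType.inp f, T)) ∨ r = (∅, (SessionType.out f, T)))} ∪
  {r | ∃ f g, (∃ x, f x ≠ SessionType.nil V) ∧
        (∀ x, f x ≠ SessionType.nil V → g x ≠ SessionType.nil V) ∧
        r = ({p | ∃ x, f x ≠ SessionType.nil V ∧ p = (f x, g x)},
             (SessionType.inp f, SessionType.inp g))} ∪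
  {r | ∃ f g, (∃ x, g x ≠ SessionType.nil V) ∧
        (∀ x, g x ≠ SessionType.nil V → f x ≠ SessionType.nil V) ∧
        r = ({p | ∃ x, g x ≠ SessionType.nil V ∧ p = (f x, g x)},
             (SessionType.out f, SessionType.out g))}

/-- Subtyping: every compliant client of `T` is a compliant client of `S`. -/
def Subt {V : Type} (T S : SessionType V) : Prop :=
  ∀ R, Compliant R T → Compliant R S

/-- Fair subtyping: every fairly compliant client of `T` is one of `S`. -/
def FairSubt {V : Type} (T S : SessionType V) : Prop :=
  ∀ R, FairCompliant R T → FairCompliant R S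

namespace SessionType

variable {V : Type}

theorem cases_nil_inp_out (T : SessionType V) :
    T = nil V ∨ (∃ f, T = inp f) ∨ ∃ f, T = out f := by
  refine PFunctor.M.casesOn (r := fun T : (STF V).M =>
    T = nil V ∨ (∃ f, T = inp f) ∨ ∃ f, T = out f) T ?_
  rintro ⟨_ | _ | _, f⟩
  · left
    have hf : f = Empty.elim := funext fun x => Empty.elim x
    rw [hf]
    rfl
  · exact Or.inr (Or.inl ⟨f, rfl⟩)
  · exact Or.inr (Or.inr ⟨f, rfl⟩)

theorem inp_injective_s17 : Function.Injective (inp (V := V)) := by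
  intro f g h
  have h' := PFunctor.M.mk_inj h
  injection h'

theorem out_injective_s17 : Function.Injective (out (V := V)) := by
  intro f g h
  have h' := PFunctor.M.mk_inj h
  injection h'

theorem inp_ne_nil (f : V → SessionType V) : inp f ≠ nil V := by
  intro h
  have h' := PFunctor.M.mk_inj h
  injection h' with h' _
  cases h'

theorem out_ne_nil (f : V → SessionType V) : out f ≠ nil V := by
  intro h
  have h' := PFunctor.M.mk_inj h
  injection h' with h' _
  cases h'

theorem inp_ne_out_s17 (f g : V → SessionType V) : inp f ≠ out g := by
  intro h
  have h' := PFunctor.M.mk_inj h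
  injection h' with h' _
  cases h'

end SessionType

section Compliance

open SessionType

variable {V : Type}

theorem transition_iff {T T' : SessionType V} {α : Act V} :
    Transition T α T' ↔
      (∃ f x, T = inp f ∧ α = .inp x ∧ T' = f x) ∨
      ∃ f x, T = out f ∧ α = .out x ∧ T' = f x ∧ f x ≠ nil V := by
  constructor
  · rintro (⟨f, x⟩ | ⟨f, x, h⟩)
    · exact Or.inl ⟨f, x, rfl, rfl, rfl⟩
    · exact Or.inr ⟨f, x, rfl, rfl, rfl, h⟩
  · rintro (⟨f, x, rfl, rfl, rfl⟩ | ⟨f, x, rfl, rfl, rfl, h⟩)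
    · exact .inp f x
    · exact .out f x h

theorem red_iff_s17 {p q : SessionType V × SessionType V} :
    Red p q ↔
      (∃ r s x, p = (out r, inp s) ∧ q = (r x, s x) ∧ r x ≠ nil V) ∨
      ∃ r s x, p = (inp r, out s) ∧ q = (r x, s x) ∧ s x ≠ nil V := by
  obtain ⟨p₁, p₂⟩ := p
  obtain ⟨q₁, q₂⟩ := q
  constructor
  · rintro ⟨x | x, h₁, h₂⟩
    · rcases transition_iff.1 h₁ with ⟨r, y, rfl, hy, rfl⟩ | ⟨r, y, rfl, hy, rfl, hr⟩ <;> cases hy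
      rcases transition_iff.1 h₂ with ⟨s, z, rfl, hz, rfl⟩ | ⟨s, z, rfl, hz, rfl, hs⟩ <;> cases hz
      exact Or.inl ⟨r, s, x, rfl, rfl, hr⟩
    · rcases transition_iff.1 h₁ with ⟨r, y, rfl, hy, rfl⟩ | ⟨r, y, rfl, hy, rfl, hr⟩ <;> cases hy
      rcases transition_iff.1 h₂ with ⟨s, z, rfl, hz, rfl⟩ | ⟨s, z, rfl, hz, rfl, hs⟩ <;> cases hz
      exact Or.inr ⟨r, s, x, rfl, rfl, hs⟩
  · rintro (⟨r, s, x, hp, hq, h⟩ | ⟨r, s, x, hp, hq, h⟩) <;> cases hp <;> cases hq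
    · exact ⟨.inp x, .out r x h, .inp s x⟩
    · exact ⟨.out x, .inp r x, .out s x h⟩

theorem red_out_inp {r s : V → SessionType V} {q : SessionType V × SessionType V} :
    Red (out r, inp s) q ↔ ∃ x, r x ≠ nil V ∧ q = (r x, s x) := by
  rw [red_iff_s17]
  constructor
  · rintro (⟨r', s', x, hp, hq, h⟩ | ⟨r', s', x, hp, hq, h⟩) <;> rw [Prod.mk.injEq] at hp
    · obtain rfl := out_injective_s17 hp.1
      obtain rfl := inp_injective_s17 hp.2
      exact ⟨x, h, hq⟩
    · exact absurd hp.2 (inp_ne_out_s17 _ _)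
  · rintro ⟨x, h, hq⟩
    exact Or.inl ⟨r, s, x, rfl, hq, h⟩

theorem red_inp_out {r s : V → SessionType V} {q : SessionType V × SessionType V} :
    Red (inp r, out s) q ↔ ∃ x, s x ≠ nil V ∧ q = (r x, s x) := by
  rw [red_iff_s17]
  constructor
  · rintro (⟨r', s', x, hp, hq, h⟩ | ⟨r', s', x, hp, hq, h⟩) <;> rw [Prod.mk.injEq] at hp
    · exact absurd hp.1 (inp_ne_out_s17 _ _)
    · obtain rfl := inp_injective_s17 hp.1
      obtain rfl := out_injective_s17 hp.2
      exact ⟨x, h, hq⟩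
  · rintro ⟨x, h, hq⟩
    exact Or.inr ⟨r, s, x, rfl, hq, h⟩

/-- Coinduction principle for compliance. -/
theorem compliant_of_invariant {P : SessionType V × SessionType V → Prop}
    (hP : ∀ p, P p → ((∀ q, ¬ Red p q) → Successful p) ∧ ∀ q, Red p q → P q)
    {R S : SessionType V} (h : P (R, S)) : Compliant R S := by
  intro p hp
  have hPp : P p := by
    induction hp with
    | refl => exact h
    | tail _ hred ih => exact (hP _ ih).2 _ hred
  exact (hP p hPp).1

theorem compliant_iff {R S : SessionType V} :
    Compliant R S ↔ ((∀ q, ¬ Red (R, S) q) → Successful (R, S)) ∧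
      ∀ q, Red (R, S) q → Compliant q.1 q.2 := by
  constructor
  · intro h
    exact ⟨h _ .refl, fun q hq p hp => h p (.head hq hp)⟩
  · rintro ⟨hstuck, hred⟩ p hp
    rcases Relation.ReflTransGen.cases_head hp with rfl | ⟨q, hq, hqp⟩
    · exact hstuck
    · exact hred q hq p hqp

theorem successful_out_iff {r : V → SessionType V} {S : SessionType V} :
    Successful (out r, S) ↔ (∀ x, r x = nil V) ∧ S ≠ nil V := by
  constructor
  · rintro ⟨⟨f, hf, hnil⟩, hS⟩
    obtain rfl := out_injective_s17 hf
    exact ⟨hnil, hS⟩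
  · rintro ⟨hnil, hS⟩
    exact ⟨⟨r, rfl, hnil⟩, hS⟩

theorem not_successful_inp (r : V → SessionType V) (S : SessionType V) :
    ¬ Successful (inp r, S) := by
  rintro ⟨⟨f, hf, _⟩, _⟩
  exact inp_ne_out_s17 _ _ hf

theorem not_compliant_nil_left (S : SessionType V) : ¬ Compliant (nil V) S := by
  intro h
  obtain ⟨⟨f, hf, _⟩, _⟩ := (compliant_iff.1 h).1 fun q hq => by
    rcases red_iff_s17.1 hq with ⟨r, s, x, hp, _⟩ | ⟨r, s, x, hp, _⟩ <;> rw [Prod.mk.injEq] at hp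
    · exact out_ne_nil _ hp.1.symm
    · exact inp_ne_nil _ hp.1.symm
  exact out_ne_nil _ hf.symm

theorem not_compliant_nil_right (R : SessionType V) : ¬ Compliant R (nil V) := by
  intro h
  refine ((compliant_iff.1 h).1 fun q hq => ?_).2 rfl
  rcases red_iff_s17.1 hq with ⟨r, s, x, hp, _⟩ | ⟨r, s, x, hp, _⟩ <;> rw [Prod.mk.injEq] at hp
  · exact inp_ne_nil _ hp.2.symm
  · exact out_ne_nil _ hp.2.symm

theorem not_compliant_inp_inp (r s : V → SessionType V) : ¬ Compliant (inp r) (inp s) := by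
  intro h
  refine not_successful_inp _ _ ((compliant_iff.1 h).1 fun q hq => ?_)
  rcases red_iff_s17.1 hq with ⟨_, _, x, hp, _⟩ | ⟨_, _, x, hp, _⟩ <;> rw [Prod.mk.injEq] at hp
  · exact inp_ne_out_s17 _ _ hp.1
  · exact inp_ne_out_s17 _ _ hp.2

theorem compliant_out_inp {r s : V → SessionType V} :
    Compliant (out r) (inp s) ↔ ∀ x, r x ≠ nil V → Compliant (r x) (s x) := by
  rw [compliant_iff]
  constructor
  · intro h x hx
    exact h.2 (r x, s x) (red_out_inp.2 ⟨x, hx, rfl⟩)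
  · intro h
    refine ⟨fun hstuck => successful_out_iff.2 ⟨fun x => ?_, inp_ne_nil _⟩, fun q hq => ?_⟩
    · by_contra hx
      exact hstuck _ (red_out_inp.2 ⟨x, hx, rfl⟩)
    · obtain ⟨x, hx, rfl⟩ := red_out_inp.1 hq
      exact h x hx

theorem compliant_inp_out {r s : V → SessionType V} :
    Compliant (inp r) (out s) ↔
      (∃ x, s x ≠ nil V) ∧ ∀ x, s x ≠ nil V → Compliant (r x) (s x) := by
  rw [compliant_iff]
  constructor
  · intro h
    refine ⟨?_, fun x hx => h.2 (r x, s x) (red_inp_out.2 ⟨x, hx, rfl⟩)⟩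
    by_contra hs
    refine not_successful_inp _ _ (h.1 fun q hq => ?_)
    obtain ⟨x, hx, _⟩ := red_inp_out.1 hq
    exact hs ⟨x, hx⟩
  · rintro ⟨⟨x, hx⟩, h⟩
    refine ⟨fun hstuck => absurd (red_inp_out.2 ⟨x, hx, rfl⟩) (hstuck _), fun q hq => ?_⟩
    obtain ⟨y, hy, rfl⟩ := red_inp_out.1 hq
    exact h y hy

theorem compliant_out_of_forall_eq_nil {r : V → SessionType V} (hr : ∀ x, r x = nil V)
    {S : SessionType V} (hS : S ≠ nil V) : Compliant (out r) S := by
  rw [compliant_iff]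
  refine ⟨fun _ => successful_out_iff.2 ⟨hr, hS⟩, fun q hq => ?_⟩
  rcases red_iff_s17.1 hq with ⟨_, _, x, hp, _, h⟩ | ⟨_, _, x, hp, _⟩ <;> rw [Prod.mk.injEq] at hp
  · obtain rfl := out_injective_s17 hp.1
    exact absurd (hr x) h
  · exact absurd hp.1.symm (inp_ne_out_s17 _ _)

theorem compliant_out_out {r s : V → SessionType V} :
    Compliant (out r) (out s) ↔ ∀ x, r x = nil V := by
  refine ⟨fun h => ?_, fun hr => compliant_out_of_forall_eq_nil hr (out_ne_nil _)⟩
  refine (successful_out_iff.1 ((compliant_iff.1 h).1 fun q hq => ?_)).1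
  rcases red_iff_s17.1 hq with ⟨_, _, x, hp, _⟩ | ⟨_, _, x, hp, _⟩ <;> rw [Prod.mk.injEq] at hp
  · exact inp_ne_out_s17 _ _ hp.2.symm
  · exact inp_ne_out_s17 _ _ hp.1.symm

/-- Only `end!` is compliant with a server that offers no continuation. -/
theorem Compliant.eq_out_of_forall_eq_nil {R : SessionType V} {f : V → SessionType V}
    (hf : ∀ x, f x = nil V) (h : Compliant R (inp f) ∨ Compliant R (out f)) :
    ∃ r, R = out r ∧ ∀ x, r x = nil V := by
  rcases R.cases_nil_inp_out with rfl | ⟨r, rfl⟩ | ⟨r, rfl⟩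
  · rcases h with h | h <;> exact absurd h (not_compliant_nil_left _)
  · rcases h with h | h
    · exact absurd h (not_compliant_inp_inp _ _)
    · obtain ⟨x, hx⟩ := (compliant_inp_out.1 h).1
      exact absurd (hf x) hx
  · refine ⟨r, rfl, ?_⟩
    rcases h with h | h
    · intro x
      by_contra hx
      have hc := compliant_out_inp.1 h x hx
      rw [hf x] at hc
      exact not_compliant_nil_right _ hc
    · exact compliant_out_out.1 h

end Compliance

section Subtyping

open SessionType

variable {V : Type}

/-- The successfully terminated client `end!`. -/
def endOut (V : Type) : SessionType V := out fun _ => nil V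

theorem endOut_ne_nil : endOut V ≠ nil V := out_ne_nil _

theorem compliant_endOut {S : SessionType V} (hS : S ≠ nil V) : Compliant (endOut V) S :=
  compliant_out_of_forall_eq_nil (fun _ => rfl) hS

open Classical in
/-- The client that sends exactly `x` and continues as `R`. -/
noncomputable def sendOnly (x : V) (R : SessionType V) : SessionType V :=
  out (Function.update (fun _ => nil V) x R)

open Classical in
/-- The client that receives any value, continuing as `R` on `x` and as `end!` otherwise. -/
noncomputable def recvWith (x : V) (R : SessionType V) : SessionType V :=
  inp (Function.update (fun _ => endOut V) x R)

theorem compliant_sendOnly_inp {x : V} {R : SessionType V} (hR : R ≠ nil V)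
    {s : V → SessionType V} : Compliant (sendOnly x R) (inp s) ↔ Compliant R (s x) := by
  rw [sendOnly, compliant_out_inp]
  constructor
  · intro h
    simpa using h x (by simpa using hR)
  · intro h y hy
    by_cases hyx : y = x
    · subst hyx
      simpa using h
    · simp [hyx] at hy

theorem not_compliant_sendOnly_out {x : V} {R : SessionType V} (hR : R ≠ nil V)
    {s : V → SessionType V} : ¬ Compliant (sendOnly x R) (out s) := by
  rw [sendOnly, compliant_out_out]
  intro h
  exact hR (by simpa using h x)

theorem compliant_recvWith_out {x : V} {R : SessionType V} {s : V → SessionType V}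
    (hs : ∃ y, s y ≠ nil V) (h : s x ≠ nil V → Compliant R (s x)) :
    Compliant (recvWith x R) (out s) := by
  refine compliant_inp_out.2 ⟨hs, fun y hy => ?_⟩
  by_cases hyx : y = x
  · subst hyx
    simpa using h hy
  · simpa [hyx] using compliant_endOut hy

theorem Compliant.of_recvWith_out {x : V} {R : SessionType V} {s : V → SessionType V}
    (h : Compliant (recvWith x R) (out s)) (hx : s x ≠ nil V) : Compliant R (s x) := by
  simpa using (compliant_inp_out.1 h).2 x hx

theorem Subt.ne_nil {T S : SessionType V} (h : Subt T S) (hT : T ≠ nil V) : S ≠ nil V := by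
  rintro rfl
  exact not_compliant_nil_right _ (h _ (compliant_endOut hT))

theorem Subt.exists_inp {f : V → SessionType V} {S : SessionType V} (h : Subt (inp f) S)
    (hf : ∃ x, f x ≠ nil V) : ∃ g, S = inp g := by
  rcases S.cases_nil_inp_out with rfl | hS | ⟨g, rfl⟩
  · exact absurd rfl (h.ne_nil (inp_ne_nil _))
  · exact hS
  · obtain ⟨x, hx⟩ := hf
    exact absurd (h _ ((compliant_sendOnly_inp endOut_ne_nil).2 (compliant_endOut hx)))
      (not_compliant_sendOnly_out endOut_ne_nil)

theorem Subt.apply_of_inp {f g : V → SessionType V} (h : Subt (inp f) (inp g)) (x : V) :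
    Subt (f x) (g x) := by
  intro R hR
  have hne : R ≠ nil V := by
    rintro rfl
    exact not_compliant_nil_left _ hR
  exact (compliant_sendOnly_inp hne).1 (h _ ((compliant_sendOnly_inp hne).2 hR))

theorem Subt.exists_out {f : V → SessionType V} {S : SessionType V} (h : Subt (out f) S)
    (hf : ∃ x, f x ≠ nil V) : ∃ g, S = out g ∧ ∃ x, g x ≠ nil V := by
  have hS : Compliant (inp fun _ => endOut V) S :=
    h _ (compliant_inp_out.2 ⟨hf, fun _ hx => compliant_endOut hx⟩)
  rcases S.cases_nil_inp_out with rfl | ⟨g, rfl⟩ | ⟨g, rfl⟩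
  · exact absurd hS (not_compliant_nil_right _)
  · exact absurd hS (not_compliant_inp_inp _ _)
  · exact ⟨g, rfl, (compliant_inp_out.1 hS).1⟩

theorem Subt.ne_nil_of_out {f g : V → SessionType V} (h : Subt (out f) (out g))
    (hf : ∃ x, f x ≠ nil V) {x : V} (hx : g x ≠ nil V) : f x ≠ nil V := by
  intro hfx
  have hc : Compliant (recvWith x (nil V)) (out f) :=
    compliant_recvWith_out hf fun hne => absurd hfx hne
  exact not_compliant_nil_left _ ((h _ hc).of_recvWith_out hx)

theorem Subt.apply_of_out {f g : V → SessionType V} (h : Subt (out f) (out g))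
    (hf : ∃ x, f x ≠ nil V) {x : V} (hx : g x ≠ nil V) : Subt (f x) (g x) :=
  fun _ hR => (h _ (compliant_recvWith_out hf fun _ => hR)).of_recvWith_out hx

theorem subt_subset_infOp :
    {p : SessionType V × SessionType V | Subt p.1 p.2} ⊆
      infOp (IF V) {p | Subt p.1 p.2} := by
  rintro ⟨T, S⟩ (h : Subt T S)
  rcases T.cases_nil_inp_out with rfl | ⟨f, rfl⟩ | ⟨f, rfl⟩
  · exact ⟨∅, Set.empty_subset _, Or.inl (Or.inl (Or.inl ⟨S, rfl⟩))⟩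
  · by_cases hf : ∃ x, f x ≠ nil V
    · obtain ⟨g, rfl⟩ := h.exists_inp hf
      refine ⟨_, ?_, Or.inl (Or.inr ⟨f, g, hf, fun x hx => (h.apply_of_inp x).ne_nil hx, rfl⟩)⟩
      rintro _ ⟨x, -, rfl⟩
      exact h.apply_of_inp x
    · push Not at hf
      exact ⟨∅, Set.empty_subset _,
        Or.inl (Or.inl (Or.inr ⟨f, S, hf, h.ne_nil (inp_ne_nil _), Or.inl rfl⟩))⟩
  · by_cases hf : ∃ x, f x ≠ nil V
    · obtain ⟨g, rfl, hg⟩ := h.exists_out hf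
      refine ⟨_, ?_, Or.inr ⟨f, g, hg, fun x hx => h.ne_nil_of_out hf hx, rfl⟩⟩
      rintro _ ⟨x, hx, rfl⟩
      exact h.apply_of_out hf hx
    · push Not at hf
      exact ⟨∅, Set.empty_subset _,
        Or.inl (Or.inl (Or.inr ⟨f, S, hf, h.ne_nil (out_ne_nil _), Or.inr rfl⟩))⟩

/-- Inversion of the rules of `IF` for membership in the coinductive interpretation. -/
theorem mem_coInd_cases {T S : SessionType V} (h : (T, S) ∈ CoInd (IF V)) :
    T = nil V ∨
    (∃ f, (∀ x, f x = nil V) ∧ S ≠ nil V ∧ (T = inp f ∨ T = out f)) ∨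
    (∃ f g, T = inp f ∧ S = inp g ∧ (∀ x, f x ≠ nil V → (f x, g x) ∈ CoInd (IF V))) ∨
    ∃ f g, T = out f ∧ S = out g ∧ (∃ x, g x ≠ nil V) ∧
      (∀ x, g x ≠ nil V → f x ≠ nil V ∧ (f x, g x) ∈ CoInd (IF V)) := by
  have h' : (T, S) ∈ infOp (IF V) (CoInd (IF V)) := by
    rw [CoInd, OrderHom.map_gfp]
    exact h
  obtain ⟨pr, hpr, ((⟨S', hr⟩ | ⟨f, S', hf, hS, hr | hr⟩) | ⟨f, g, -, -, hr⟩) |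
    ⟨f, g, hg, hfg, hr⟩⟩ := h' <;> cases hr
  · exact Or.inl rfl
  · exact Or.inr (Or.inl ⟨f, hf, hS, Or.inl rfl⟩)
  · exact Or.inr (Or.inl ⟨f, hf, hS, Or.inr rfl⟩)
  · exact Or.inr (Or.inr (Or.inl ⟨f, g, rfl, rfl, fun x hx => hpr ⟨x, hx, rfl⟩⟩))
  · exact Or.inr (Or.inr (Or.inr
      ⟨f, g, rfl, rfl, hg, fun x hx => ⟨hfg x hx, hpr ⟨x, hx, rfl⟩⟩⟩))

theorem subt_of_mem_coInd {T S : SessionType V} (h : (T, S) ∈ CoInd (IF V)) : Subt T S := by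
  intro R hR
  refine compliant_of_invariant
    (P := fun p => Compliant p.1 p.2 ∨ ∃ T', (T', p.2) ∈ CoInd (IF V) ∧ Compliant p.1 T')
    ?_ (Or.inr ⟨T, h, hR⟩)
  rintro ⟨R, S⟩ (hRS | ⟨T, hTS, hRT⟩)
  · have := compliant_iff.1 hRS
    exact ⟨this.1, fun q hq => Or.inl (this.2 q hq)⟩
  · rcases mem_coInd_cases hTS with rfl | ⟨f, hf, hS, hT⟩ | ⟨f, g, rfl, rfl, hfg⟩ |
      ⟨f, g, rfl, rfl, ⟨x, hx⟩, hfg⟩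
    · exact absurd hRT (not_compliant_nil_right _)
    · have hRT' : Compliant R (inp f) ∨ Compliant R (out f) := by
        rcases hT with rfl | rfl
        exacts [Or.inl hRT, Or.inr hRT]
      obtain ⟨r, rfl, hr⟩ := Compliant.eq_out_of_forall_eq_nil hf hRT'
      have := compliant_iff.1 (compliant_out_of_forall_eq_nil hr hS)
      exact ⟨this.1, fun q hq => Or.inl (this.2 q hq)⟩
    · rcases R.cases_nil_inp_out with rfl | ⟨r, rfl⟩ | ⟨r, rfl⟩
      · exact absurd hRT (not_compliant_nil_left _)
      · exact absurd hRT (not_compliant_inp_inp _ _)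
      · refine ⟨fun hstuck => successful_out_iff.2 ⟨fun x => ?_, inp_ne_nil _⟩, fun q hq => ?_⟩
        · by_contra hx
          exact hstuck _ (red_out_inp.2 ⟨x, hx, rfl⟩)
        · obtain ⟨x, hx, rfl⟩ := red_out_inp.1 hq
          have hc := compliant_out_inp.1 hRT x hx
          refine Or.inr ⟨f x, hfg x fun hfx => ?_, hc⟩
          rw [hfx] at hc
          exact not_compliant_nil_right _ hc
    · rcases R.cases_nil_inp_out with rfl | ⟨r, rfl⟩ | ⟨r, rfl⟩
      · exact absurd hRT (not_compliant_nil_left _)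
      · refine ⟨fun hstuck => absurd (red_inp_out.2 ⟨x, hx, rfl⟩) (hstuck _), fun q hq => ?_⟩
        obtain ⟨y, hy, rfl⟩ := red_inp_out.1 hq
        exact Or.inr ⟨f y, (hfg y hy).2, (compliant_inp_out.1 hRT).2 y (hfg y hy).1⟩
      · have := compliant_iff.1
          (compliant_out_out.2 (compliant_out_out.1 hRT) : Compliant (out r) (out g))
        exact ⟨this.1, fun q hq => Or.inl (this.2 q hq)⟩

end Subtyping

/-- Subtyping coincides with the coinductive interpretation of the plain rules
of the fair-subtyping GIS. -/
theorem stmt17 {V : Type} [Nontrivial V] (T S : SessionType V) :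
    Subt T S ↔ (T, S) ∈ CoInd (IF V) := by
  exact ⟨fun h => OrderHom.le_gfp _ subt_subset_infOp h, subt_of_mem_coInd⟩
end
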